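/- Let a₁, a₂ ∈ ℝ² be linearly independent vectors, let Γ := { m·a₁ + n·a₂ : m, n ∈ ℤ } be the lattice they generate, and let Λ₁ := { y₁·a₁ + y₂·a₂ : y₁, y₂ ∈ [−1/2, 1/2] } be the unit cell. Let b₀ ∈ ℝ, let A_per : ℝ² → ℝ² be continuous and Γ-periodic, and set A(x) := (b₀/2)·(−x₂, x₁) + A_per(x). Let p be a JCEL kernel satisfying the magnetic periodicity condition (mpc) with respect to A and Γ, with (p ∘ p)(x,x') = p(x,x') and p(x,x') = conj(p(x',x)) for all x, x'. Let V be a JCEL kernel satisfying the mpc with respect to A and Γ; set V*(x,x') := conj(V(x',x)) and assume the kernel identities V + V* + V ∘ V* = 0 and V + V* + V* ∘ V = 0 (expressing that U := Id + V is unitary). Define p_U := p + V ∘ p + p ∘ V* + V ∘ (p ∘ V*) (the kernel of U·P·U⁻¹). For a kernel q and for (i,j) with {i,j} = {1,2}, define W_q(x) := ∫_{ℝ²}∫_{ℝ²} q(x,y)·q(y,z)·q(z,x)·(y_i·z_j − y_j·z_i) dz dy. Then the integrals defining W_{p_U}(x) and W_p(x) converge absolutely for every x, and ∫_{Λ₁}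 W_{p_U}(x) dx = ∫_{Λ₁} W_p(x) dx. -/

import Mathlib

open MeasureTheory RealInnerProductSpace

noncomputable section

/-- The Euclidean plane `ℝ²`. -/
abbrev R2 : Type := EuclideanSpace ℝ (Fin 2)

/-- Building a vector in `ℝ²` from its two coordinates. -/
noncomputable def vec2 (s t : ℝ) : R2 := (WithLp.equiv 2 (Fin 2 → ℝ)).symm ![s, t]

/-- The lattice `Γ = ℤa₁ + ℤa₂` generated by `a₁, a₂ ∈ ℝ²`. -/
def lattice (a₁ a₂ : R2) : Set R2 := {γ | ∃ m n : ℤ, γ = m • a₁ + n • a₂}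

/-- The unit cell `Λ₁ = { y₁a₁ + y₂a₂ : y₁, y₂ ∈ [−1/2, 1/2] }`. -/
def unitCell (a₁ a₂ : R2) : Set R2 :=
  {x | ∃ y₁ y₂ : ℝ, y₁ ∈ Set.Icc (-(1/2) : ℝ) (1/2) ∧ y₂ ∈ Set.Icc (-(1/2) : ℝ) (1/2) ∧
    x = y₁ • a₁ + y₂ • a₂}

/-- A kernel `K : ℝ² × ℝ² → ℂ` is *jointly continuous exponentially localized* (JCEL) with
localization constants `(C, β)` if it is jointly continuous and
`|K(x,x')| ≤ C·exp(−β·‖x−x'‖)` for all `x, x'`. -/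
def JCEL (K : R2 × R2 → ℂ) (C β : ℝ) : Prop :=
  Continuous K ∧ ∀ x x' : R2, ‖K (x, x')‖ ≤ C * Real.exp (-β * ‖x - x'‖)

/-- The magnetic periodicity condition (mpc) for a kernel `K` with respect to a vector
potential `A` and a lattice `Γ`. -/
def MPC (A : R2 → R2) (Γ : Set R2) (K : R2 × R2 → ℂ) : Prop :=
  ∀ γ ∈ Γ, ∀ x x' : R2,
    Complex.exp (-Complex.I * (⟪A x, γ⟫ : ℝ)) * K (x - γ, x') =
      K (x, x' + γ) * Complex.exp (-Complex.I * (⟪A (x' + γ), γ⟫ : ℝ))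

/-- Composition of kernels: `(K₁ ∘ K₂)(x,x') = ∫ K₁(x,y)·K₂(y,x') dy`. -/
noncomputable def compK (K₁ K₂ : R2 × R2 → ℂ) : R2 × R2 → ℂ :=
  fun p => ∫ y : R2, K₁ (p.1, y) * K₂ (y, p.2)

/-- The adjoint kernel `V*(x,x') := conj(V(x',x))`. -/
def starK (V : R2 × R2 → ℂ) : R2 × R2 → ℂ := fun p => (starRingEnd ℂ) (V (p.2, p.1))

/-- The kernel of `U·P·U⁻¹` for `U = Id + V`: `p_U = p + V∘p + p∘V* + V∘(p∘V*)`. -/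
noncomputable def conjK (p V : R2 × R2 → ℂ) : R2 × R2 → ℂ :=
  fun q => p q + compK V p q + compK p (starK V) q + compK V (compK p (starK V)) q

/-- The integrand of the Chern–Simons diagonal `W_q(x)`:
`q(x,y)·q(y,z)·q(z,x)·(y_i·z_j − y_j·z_i)`, as a function of `(y,z) ∈ ℝ² × ℝ²`. -/
noncomputable def Wint (q : R2 × R2 → ℂ) (i j : Fin 2) (x : R2) : R2 × R2 → ℂ :=
  fun yz => q (x, yz.1) * q (yz.1, yz.2) * q (yz.2, x) *
    ((yz.1 i * yz.2 j - yz.1 j * yz.2 i : ℝ) : ℂ)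

/-- `W_q(x) := ∫∫ q(x,y)·q(y,z)·q(z,x)·(y_i·z_j − y_j·z_i) dz dy`. -/
noncomputable def W (q : R2 × R2 → ℂ) (i j : Fin 2) (x : R2) : ℂ :=
  ∫ y : R2, ∫ z : R2, q (x, y) * q (y, z) * q (z, x) * ((y i * z j - y j * z i : ℝ) : ℂ)

section ChernTrace

variable {R M : Type*} [Ring R] [AddCommGroup M] (D₁ D₂ : R →+ R) (T : R →+ M)

/-- The corner `e (D e) e` vanishes for a derivation `D` and an idempotent `e`. -/
lemma idem_mul_deriv_mul_idem (h : ∀ a b, D₁ (a * b) = D₁ a * b + a * D₁ b) {e : R}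
    (he : e * e = e) : e * D₁ e * e = 0 := by
  have h1 := h e e
  rw [he] at h1
  have h2 : e * D₁ e * e = e * (D₁ e * e + e * D₁ e) * e := by rw [← h1]
  have h3 : e * (D₁ e * e + e * D₁ e) * e = e * D₁ e * (e * e) + (e * e) * D₁ e * e := by
    noncomm_ring
  rw [h3, he] at h2
  simpa using h2

lemma deriv_inverse (h : ∀ a b, D₁ (a * b) = D₁ a * b + a * D₁ b) {u w : R}
    (huw : u * w = 1) (hwu : w * u = 1) : D₁ w = -(w * D₁ u * w) := by
  have h1 : D₁ 1 = 0 := by simpa using h 1 1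
  have h2 := h w u
  rw [hwu, h1] at h2
  calc D₁ w = D₁ w * (u * w) := by rw [huw, mul_one]
    _ = (D₁ w * u + w * D₁ u) * w - w * D₁ u * w := by noncomm_ring
    _ = _ := by rw [← h2]; noncomm_ring

/-- A derivation `D` transforms under conjugation into `D + ad (u⁻¹ D u)`. -/
lemma deriv_conj (h : ∀ a b, D₁ (a * b) = D₁ a * b + a * D₁ b) {u w : R}
    (huw : u * w = 1) (hwu : w * u = 1) (e : R) :
    D₁ (u * e * w) = u * (D₁ e + w * D₁ u * e - e * (w * D₁ u)) * w := by
  rw [h, h, deriv_inverse D₁ h huw hwu]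
  calc _ = 1 * D₁ u * e * w + u * D₁ e * w - u * e * w * D₁ u * w := by noncomm_ring
    _ = (u * w) * D₁ u * e * w + u * D₁ e * w - u * e * w * D₁ u * w := by rw [huw]
    _ = _ := by noncomm_ring

/-- The curvature of the flat connection `u⁻¹ D u` vanishes. -/
lemma deriv_maurerCartan (h₁ : ∀ a b, D₁ (a * b) = D₁ a * b + a * D₁ b)
    {u w : R} (huw : u * w = 1) (hwu : w * u = 1) :
    D₁ (w * D₂ u) = w * D₁ (D₂ u) - w * D₁ u * (w * D₂ u) := by
  rw [h₁, deriv_inverse D₁ h₁ huw hwu]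
  noncomm_ring

/-- Expansion of the mixed term `e [D e, [B, e]]` under a trace. -/
lemma trace_mixed (cyc : ∀ a b, T (a * b) = T (b * a))
    (h : ∀ a b, D₁ (a * b) = D₁ a * b + a * D₁ b) (hT : ∀ a, T (D₁ a) = 0) {e : R}
    (he : e * e = e) (B : R) :
    T (e * (D₁ e * (B * e - e * B) - (B * e - e * B) * D₁ e)) = -T (D₁ B * e) := by
  have hc := idem_mul_deriv_mul_idem D₁ h he
  have hd : D₁ e = D₁ e * e + e * D₁ e := by conv_lhs => rw [← he, h]
  have h1 : e * (D₁ e * (B * e - e * B) - (B * e - e * B) * D₁ e)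
      = e * (D₁ e * B * e) - e * D₁ e * e * B - e * (B * e * D₁ e) + e * e * B * D₁ e := by
    noncomm_ring
  have h2 : T (e * (D₁ e * B * e)) = T (B * (e * D₁ e)) := by
    rw [cyc, show D₁ e * B * e * e = D₁ e * B * (e * e) by noncomm_ring, he, mul_assoc, cyc,
      mul_assoc]
  have h3 : T (e * (B * e * D₁ e)) = 0 := by
    rw [cyc, show B * e * D₁ e * e = B * (e * D₁ e * e) by noncomm_ring, hc]; simp
  have h4 : T (e * e * B * D₁ e) = T (B * (D₁ e * e)) := by
    rw [he, mul_assoc, cyc, mul_assoc]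
  have h5 : T (D₁ B * e) + T (B * D₁ e) = 0 := by rw [← map_add, ← h, hT]
  rw [h1, map_add, map_sub, map_sub, h2, h3, h4, hc, zero_mul, map_zero, sub_zero, sub_zero,
    ← map_add, ← mul_add, add_comm (e * D₁ e), ← hd]
  exact eq_neg_of_add_eq_zero_right h5

/-- Expansion of `e [[B₁, e], [B₂, e]]` under a trace. -/
lemma trace_quadratic (cyc : ∀ a b, T (a * b) = T (b * a)) {e : R} (he : e * e = e)
    (B₁ B₂ : R) :
    T (e * ((B₁ * e - e * B₁) * (B₂ * e - e * B₂) - (B₂ * e - e * B₂) * (B₁ * e - e * B₁)))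
      = T ((B₂ * B₁ - B₁ * B₂) * e) := by
  have key : ∀ X Y : R, T (e * ((X * e - e * X) * (Y * e - e * Y)))
      = T (e * X * (e * Y)) - T (X * Y * e) := by
    intro X Y
    have h1 : e * ((X * e - e * X) * (Y * e - e * Y))
        = e * (X * e * Y * e) - e * X * (e * e) * Y - e * e * X * Y * e + e * e * X * e * Y := by
      noncomm_ring
    have h2 : T (e * (X * e * Y * e)) = T (e * X * (e * Y)) := by
      rw [cyc, show X * e * Y * e * e = X * e * Y * (e * e) by noncomm_ring, he, cyc]
      congr 1; noncomm_ring
    have h3 : T (e * X * Y * e) = T (X * Y * e) := by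
      rw [cyc, show e * (e * X * Y) = e * e * (X * Y) by noncomm_ring, he, cyc]
    rw [h1, he, map_add, map_sub, map_sub, h2, h3, ← mul_assoc]
    abel
  rw [mul_sub, map_sub, key, key, cyc (e * B₁), sub_mul, map_sub]
  abel

/-- Invariance of the Chern number `T (e [D₁ e, D₂ e])` of an idempotent under conjugation, for
a trace `T` which is invariant under the commuting derivations `D₁`, `D₂`. -/
theorem trace_chern_conj (cyc : ∀ a b, T (a * b) = T (b * a))
    (h₁ : ∀ a b, D₁ (a * b) = D₁ a * b + a * D₁ b)
    (h₂ : ∀ a b, D₂ (a * b) = D₂ a * b + a * D₂ b)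
    (hcomm : ∀ a, D₁ (D₂ a) = D₂ (D₁ a))
    (hT₁ : ∀ a, T (D₁ a) = 0) (hT₂ : ∀ a, T (D₂ a) = 0)
    {e u w : R} (he : e * e = e) (huw : u * w = 1) (hwu : w * u = 1) :
    T (u * e * w * (D₁ (u * e * w) * D₂ (u * e * w) - D₂ (u * e * w) * D₁ (u * e * w)))
      = T (e * (D₁ e * D₂ e - D₂ e * D₁ e)) := by
  rw [deriv_conj D₁ h₁ huw hwu, deriv_conj D₂ h₂ huw hwu]
  have hf₁ := deriv_maurerCartan D₁ D₂ h₁ huw hwu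
  have hf₂ := deriv_maurerCartan D₂ D₁ h₂ huw hwu
  have hm₁ := trace_mixed D₁ T cyc h₁ hT₁ he (w * D₂ u)
  have hm₂ := trace_mixed D₂ T cyc h₂ hT₂ he (w * D₁ u)
  have hq := trace_quadratic T cyc he (w * D₁ u) (w * D₂ u)
  rw [hf₁, hcomm] at hm₁
  rw [hf₂] at hm₂
  generalize w * D₁ u = B₁ at *
  generalize w * D₂ u = B₂ at *
  generalize hE₁ : D₁ e + B₁ * e - e * B₁ = E₁
  generalize hE₂ : D₂ e + B₂ * e - e * B₂ = E₂
  have h1 : u * e * w * (u * E₁ * w * (u * E₂ * w) - u * E₂ * w * (u * E₁ * w))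
      = u * (e * (E₁ * E₂ - E₂ * E₁) * w) := by
    calc _ = u * e * (w * u) * E₁ * (w * u) * E₂ * w
          - u * e * (w * u) * E₂ * (w * u) * E₁ * w := by noncomm_ring
      _ = _ := by rw [hwu]; noncomm_ring
  have h2 : e * (E₁ * E₂ - E₂ * E₁) = e * (D₁ e * D₂ e - D₂ e * D₁ e)
      + e * (D₁ e * (B₂ * e - e * B₂) - (B₂ * e - e * B₂) * D₁ e)
      - e * (D₂ e * (B₁ * e - e * B₁) - (B₁ * e - e * B₁) * D₂ e)
      + e * ((B₁ * e - e * B₁) * (B₂ * e - e * B₂)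
        - (B₂ * e - e * B₂) * (B₁ * e - e * B₁)) := by
    rw [← hE₁, ← hE₂]; noncomm_ring
  rw [h1, cyc, mul_assoc, hwu, mul_one, h2, map_add, map_sub, map_add, hm₁, hm₂, hq,
    sub_mul, sub_mul, sub_mul, map_sub, map_sub, map_sub]
  abel

end ChernTrace

section Localized

lemma integrable_exp_neg_mul_norm {β : ℝ} (hβ : 0 < β) :
    Integrable fun x : R2 => Real.exp (-β * ‖x‖) := by
  have h3 : Integrable fun x : R2 => (1 + ‖x‖) ^ (-(3 : ℝ)) :=
    integrable_one_add_norm (by simp; norm_num)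
  refine (h3.const_mul ((1 + 3 / β) ^ 3)).mono' (by fun_prop) (.of_forall fun x => ?_)
  have hr := norm_nonneg x
  rw [Real.norm_of_nonneg (Real.exp_pos _).le, Real.rpow_neg (by positivity), ← div_eq_mul_inv,
    le_div_iff₀ (by positivity)]
  have h1 : 1 + ‖x‖ ≤ (1 + 3 / β) * Real.exp (β / 3 * ‖x‖) := by
    have h2 := Real.add_one_le_exp (β / 3 * ‖x‖)
    calc 1 + ‖x‖ ≤ (1 + 3 / β) * (β / 3 * ‖x‖ + 1) := by
          have h4 : (1 + 3 / β) * (β / 3 * ‖x‖ + 1) = 1 + ‖x‖ + (β / 3 * ‖x‖ + 3 / β) := by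
            field_simp; ring
          rw [h4]; exact le_add_of_nonneg_right (by positivity)
      _ ≤ _ := by gcongr
  have h5 : (1 + ‖x‖) ^ (3 : ℝ) ≤ (1 + 3 / β) ^ 3 * Real.exp (β * ‖x‖) := by
    have h6 : (1 + ‖x‖) ^ (3 : ℝ) = (1 + ‖x‖) ^ 3 := by exact_mod_cast Real.rpow_natCast _ 3
    rw [h6]
    calc (1 + ‖x‖) ^ 3 ≤ ((1 + 3 / β) * Real.exp (β / 3 * ‖x‖)) ^ 3 := by gcongr
      _ = _ := by rw [mul_pow, ← Real.exp_nat_mul]; congr 2; push_cast; ring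
  calc _ ≤ Real.exp (-β * ‖x‖) * ((1 + 3 / β) ^ 3 * Real.exp (β * ‖x‖)) := by gcongr
    _ = (1 + 3 / β) ^ 3 * Real.exp (-β * ‖x‖ + β * ‖x‖) := by rw [Real.exp_add]; ring
    _ = _ := by simp

lemma integrable_exp_neg_mul_norm_sub {β : ℝ} (hβ : 0 < β) (x : R2) :
    Integrable fun y : R2 => Real.exp (-β * ‖x - y‖) :=
  (integrable_exp_neg_mul_norm hβ).comp_sub_left x

/-- A kernel which is JCEL for some localization constants. -/
def IsLocalized (K : R2 × R2 → ℂ) : Prop := ∃ C β : ℝ, 0 < β ∧ JCEL K C β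

lemma JCEL.nonneg {K : R2 × R2 → ℂ} {C β : ℝ} (h : JCEL K C β) : 0 ≤ C := by
  simpa using (norm_nonneg _).trans (h.2 0 0)

lemma JCEL.mono {K : R2 × R2 → ℂ} {C β β' : ℝ} (h : JCEL K C β) (hβ : β' ≤ β) :
    JCEL K C β' := by
  refine ⟨h.1, fun x x' => (h.2 x x').trans ?_⟩
  have := h.nonneg
  gcongr

lemma JCEL.norm_le {K : R2 × R2 → ℂ} {C β : ℝ} (h : JCEL K C β) (hβ : 0 < β) (x y : R2) :
    ‖K (x, y)‖ ≤ C := by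
  refine (h.2 x y).trans (mul_le_of_le_one_right h.nonneg ?_)
  rw [Real.exp_le_one_iff, neg_mul, neg_nonpos]
  positivity

/-- Two localized kernels admit a common rate of decay. -/
lemma IsLocalized.common {K L : R2 × R2 → ℂ} (hK : IsLocalized K) (hL : IsLocalized L) :
    ∃ C C' β : ℝ, 0 < β ∧ JCEL K C β ∧ JCEL L C' β := by
  obtain ⟨C, β, hβ, h⟩ := hK
  obtain ⟨C', β', hβ', h'⟩ := hL
  exact ⟨C, C', min β β', lt_min hβ hβ', h.mono (min_le_left _ _), h'.mono (min_le_right _ _)⟩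

lemma IsLocalized.continuous {K : R2 × R2 → ℂ} (hK : IsLocalized K) : Continuous K := by
  obtain ⟨C, β, -, h⟩ := hK
  exact h.1

lemma isLocalized_zero : IsLocalized 0 :=
  ⟨0, 1, one_pos, continuous_const, fun x y => by simp⟩

lemma IsLocalized.add {K L : R2 × R2 → ℂ} (hK : IsLocalized K) (hL : IsLocalized L) :
    IsLocalized (K + L) := by
  obtain ⟨C, C', β, hβ, h, h'⟩ := hK.common hL
  refine ⟨C + C', β, hβ, h.1.add h'.1, fun x y => ?_⟩
  rw [add_mul]
  exact norm_add_le_of_le (h.2 x y) (h'.2 x y)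

lemma IsLocalized.neg {K : R2 × R2 → ℂ} (hK : IsLocalized K) : IsLocalized (-K) := by
  obtain ⟨C, β, hβ, h⟩ := hK
  exact ⟨C, β, hβ, h.1.neg, fun x y => by simpa using h.2 x y⟩

lemma IsLocalized.starK {K : R2 × R2 → ℂ} (hK : IsLocalized K) : IsLocalized (starK K) := by
  obtain ⟨C, β, hβ, h⟩ := hK
  refine ⟨C, β, hβ, ?_, fun x y => ?_⟩
  · have := h.1
    unfold _root_.starK
    fun_prop
  · simpa [_root_.starK, norm_sub_rev x y] using h.2 y x

lemma IsLocalized.integrable_mul {K L : R2 × R2 → ℂ} (hK : IsLocalized K) (hL : IsLocalized L)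
    (x z : R2) : Integrable fun y : R2 => K (x, y) * L (y, z) := by
  obtain ⟨C, C', β, hβ, h, h'⟩ := hK.common hL
  have hKc := h.1
  have hLc := h'.1
  refine (((integrable_exp_neg_mul_norm_sub hβ x).const_mul C).mul_const C').mono'
    (by fun_prop) (.of_forall fun y => ?_)
  rw [norm_mul]
  have := h.nonneg
  gcongr
  · exact h.2 x y
  · exact h'.norm_le hβ y z

lemma IsLocalized.compK {K L : R2 × R2 → ℂ} (hK : IsLocalized K) (hL : IsLocalized L) :
    IsLocalized (compK K L) := by
  obtain ⟨C, C', β, hβ, h, h'⟩ := hK.common hL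
  have hKc := h.1
  have hLc := h'.1
  have hC := h.nonneg
  have hC' := h'.nonneg
  refine ⟨C * C' * ∫ y : R2, Real.exp (-(β / 2) * ‖y‖), β / 2, by positivity, ?_,
    fun x z => ?_⟩
  · have heq : _root_.compK K L
        = fun q : R2 × R2 => ∫ y : R2, K (q.1, q.1 - y) * L (q.1 - y, q.2) := by
      ext q
      exact (integral_sub_left_eq_self (fun y => K (q.1, y) * L (y, q.2)) volume q.1).symm
    rw [heq]
    refine continuous_of_dominated (bound := fun y : R2 => C * Real.exp (-β * ‖y‖) * C')
      (fun q => by fun_prop) (fun q => .of_forall fun y => ?_)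
      (((integrable_exp_neg_mul_norm hβ).const_mul C).mul_const C')
      (.of_forall fun y => by fun_prop)
    rw [norm_mul]
    gcongr
    · simpa using h.2 q.1 (q.1 - y)
    · exact h'.norm_le hβ _ _
  · calc ‖_root_.compK K L (x, z)‖
        ≤ ∫ y : R2, C * C' * Real.exp (-(β / 2) * ‖x - z‖)
            * Real.exp (-(β / 2) * ‖x - y‖) := by
          refine norm_integral_le_of_norm_le
            ((integrable_exp_neg_mul_norm_sub (by positivity) x).const_mul _)
            (.of_forall fun y => ?_)
          have ht : ‖x - z‖ ≤ ‖x - y‖ + ‖y - z‖ := norm_sub_le_norm_sub_add_norm_sub x y z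
          have hn := norm_nonneg (y - z)
          calc ‖K (x, y) * L (y, z)‖
              ≤ (C * Real.exp (-β * ‖x - y‖)) * (C' * Real.exp (-β * ‖y - z‖)) := by
                rw [norm_mul]
                gcongr
                · exact h.2 x y
                · exact h'.2 y z
            _ = C * C' * Real.exp (-β * ‖x - y‖ + -β * ‖y - z‖) := by
                rw [Real.exp_add]; ring
            _ ≤ C * C' * Real.exp (-(β / 2) * ‖x - z‖ + -(β / 2) * ‖x - y‖) := by
                refine mul_le_mul_of_nonneg_left (Real.exp_le_exp.2 ?_) (by positivity)
                nlinarith [mul_le_mul_of_nonneg_left ht hβ.le, mul_nonneg hβ.le hn]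
            _ = _ := by rw [Real.exp_add]; ring
      _ = _ := by
          rw [integral_const_mul,
            integral_sub_left_eq_self (fun y : R2 => Real.exp (-(β / 2) * ‖y‖)) volume x]
          ring

/-- The chain `K(x,y) L(y,z) M(z,w)` is absolutely integrable in `(y,z)`. -/
lemma IsLocalized.integrable_chain {K L M : R2 × R2 → ℂ} (hK : IsLocalized K)
    (hL : IsLocalized L) (hM : IsLocalized M) (x w : R2) :
    Integrable fun q : R2 × R2 => K (x, q.1) * (L (q.1, q.2) * M (q.2, w)) := by
  obtain ⟨C, C', β, hβ, h, h'⟩ := hK.common hM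
  obtain ⟨D, δ, hδ, hD⟩ := hL
  have hKc := h.1
  have hMc := h'.1
  have hLc := hD.1
  have hC := h.nonneg
  have hC' := h'.nonneg
  refine (((integrable_exp_neg_mul_norm_sub hβ x).const_mul C).mul_prod
    (((integrable_exp_neg_mul_norm_sub hβ w).const_mul C').const_mul D)).mono'
    (by fun_prop) (.of_forall fun q => ?_)
  rw [norm_mul, norm_mul]
  have := hD.nonneg
  gcongr
  · exact h.2 x q.1
  · exact hD.norm_le hδ _ _
  · rw [norm_sub_rev]; exact h'.2 q.2 w

lemma integral_chain {K L M : R2 × R2 → ℂ} (hK : IsLocalized K)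
    (hL : IsLocalized L) (hM : IsLocalized M) (x w : R2) :
    ∫ q : R2 × R2, K (x, q.1) * (L (q.1, q.2) * M (q.2, w)) = compK K (compK L M) (x, w) := by
  rw [Measure.volume_eq_prod, integral_prod _ (hK.integrable_chain hL hM x w)]
  simp only [integral_const_mul, compK]

lemma compK_assoc {K L M : R2 × R2 → ℂ} (hK : IsLocalized K)
    (hL : IsLocalized L) (hM : IsLocalized M) :
    compK (compK K L) M = compK K (compK L M) := by
  ext ⟨x, w⟩
  rw [← integral_chain hK hL hM, Measure.volume_eq_prod,
    integral_prod_symm _ (hK.integrable_chain hL hM x w)]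
  simp only [compK, ← integral_mul_const, mul_assoc]

lemma compK_add_left {K L M : R2 × R2 → ℂ} (hK : IsLocalized K)
    (hL : IsLocalized L) (hM : IsLocalized M) :
    compK (K + L) M = compK K M + compK L M := by
  ext ⟨x, w⟩
  simp only [compK, Pi.add_apply, add_mul]
  exact integral_add (hK.integrable_mul hM x w) (hL.integrable_mul hM x w)

lemma compK_add_right {K L M : R2 × R2 → ℂ} (hK : IsLocalized K)
    (hL : IsLocalized L) (hM : IsLocalized M) :
    compK K (L + M) = compK K L + compK K M := by
  ext ⟨x, w⟩
  simp only [compK, Pi.add_apply, mul_add]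
  exact integral_add (hK.integrable_mul hL x w) (hK.integrable_mul hM x w)

/-- The kernel `(xᵢ - x'ᵢ) K(x,x')` of the commutator `[Xᵢ, K]`. -/
def posComm (i : Fin 2) (K : R2 × R2 → ℂ) : R2 × R2 → ℂ :=
  fun q => ((q.1 i - q.2 i : ℝ) : ℂ) * K q

lemma IsLocalized.posComm {K : R2 × R2 → ℂ} (hK : IsLocalized K) (i : Fin 2) :
    IsLocalized (posComm i K) := by
  obtain ⟨C, β, hβ, h⟩ := hK
  have hKc := h.1
  refine ⟨2 / β * C, β / 2, by positivity, ?_, fun x y => ?_⟩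
  · unfold _root_.posComm
    fun_prop
  · have hC := h.nonneg
    have h1 : |x i - y i| ≤ ‖x - y‖ := by
      simpa using PiLp.norm_apply_le (x - y) i
    have h2 : ‖x - y‖ ≤ 2 / β * Real.exp (β / 2 * ‖x - y‖) := by
      calc ‖x - y‖ = 2 / β * (β / 2 * ‖x - y‖) := by field_simp
        _ ≤ _ := by gcongr; linarith [Real.add_one_le_exp (β / 2 * ‖x - y‖)]
    calc ‖_root_.posComm i K (x, y)‖ = |x i - y i| * ‖K (x, y)‖ := by
          simp only [_root_.posComm, norm_mul, Complex.norm_real, Real.norm_eq_abs]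
      _ ≤ (2 / β * Real.exp (β / 2 * ‖x - y‖)) * (C * Real.exp (-β * ‖x - y‖)) := by
          gcongr
          · exact h1.trans h2
          · exact h.2 x y
      _ = 2 / β * C * Real.exp (β / 2 * ‖x - y‖ + -β * ‖x - y‖) := by rw [Real.exp_add]; ring
      _ = _ := by congr 2; ring

lemma posComm_compK {K L : R2 × R2 → ℂ} (hK : IsLocalized K) (hL : IsLocalized L) (i : Fin 2) :
    posComm i (compK K L) = compK (posComm i K) L + compK K (posComm i L) := by
  ext ⟨x, z⟩
  simp only [posComm, compK, Pi.add_apply, ← integral_const_mul]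
  refine Eq.trans (integral_congr_ae (.of_forall fun y => ?_))
    (integral_add ((hK.posComm i).integrable_mul hL x z)
      (hK.integrable_mul (hL.posComm i) x z))
  push_cast
  ring

end Localized

section Covariant

/-- A kernel `K` is covariant if simultaneous translation of both arguments by `γ ∈ Γ` multiplies
it by the magnetic phase `exp(i (A(x) - A(y))·γ)`. -/
def IsCovariant (A : R2 → R2) (Γ : Set R2) (K : R2 × R2 → ℂ) : Prop :=
  ∀ γ ∈ Γ, ∀ x y : R2,
    K (x - γ, y - γ) = Complex.exp (Complex.I * ((⟪A x, γ⟫ : ℝ) - (⟪A y, γ⟫ : ℝ))) * K (x, y)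

variable {A : R2 → R2} {Γ : Set R2} {K L : R2 × R2 → ℂ}

lemma MPC.isCovariant (h : MPC A Γ K) : IsCovariant A Γ K := by
  intro γ hγ x y
  have h1 := h γ hγ x (y - γ)
  rw [sub_add_cancel] at h1
  have h2 : Complex.exp (Complex.I * (⟪A x, γ⟫ : ℝ)) * Complex.exp (-Complex.I * (⟪A x, γ⟫ : ℝ))
      = 1 := by rw [← Complex.exp_add]; simp
  calc K (x - γ, y - γ)
      = Complex.exp (Complex.I * (⟪A x, γ⟫ : ℝ))
        * (Complex.exp (-Complex.I * (⟪A x, γ⟫ : ℝ)) * K (x - γ, y - γ)) := by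
        rw [← mul_assoc, h2, one_mul]
    _ = Complex.exp (Complex.I * (⟪A x, γ⟫ : ℝ)) * Complex.exp (-Complex.I * (⟪A y, γ⟫ : ℝ))
        * K (x, y) := by rw [h1]; ring
    _ = _ := by rw [← Complex.exp_add]; congr 2; ring

lemma IsCovariant.starK (h : IsCovariant A Γ K) : IsCovariant A Γ (starK K) := by
  intro γ hγ x y
  simp only [_root_.starK, h γ hγ y x, map_mul, ← Complex.exp_conj, map_sub, Complex.conj_I,
    Complex.conj_ofReal]
  congr 2
  ring

lemma IsCovariant.mul_swap (hK : IsCovariant A Γ K) (hL : IsCovariant A Γ L) {γ : R2}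
    (hγ : γ ∈ Γ) (x y : R2) :
    K (x - γ, y - γ) * L (y - γ, x - γ) = K (x, y) * L (y, x) := by
  rw [hK γ hγ, hL γ hγ, mul_mul_mul_comm, ← Complex.exp_add, ← mul_add]
  simp

lemma IsCovariant.compK (hK : IsCovariant A Γ K) (hL : IsCovariant A Γ L) :
    IsCovariant A Γ (compK K L) := by
  intro γ hγ x z
  simp only [_root_.compK]
  rw [← integral_sub_right_eq_self (fun y => K (x - γ, y) * L (y, z - γ)) γ, ← integral_const_mul]
  congr 1 with y
  rw [hK γ hγ, hL γ hγ, mul_mul_mul_comm, ← Complex.exp_add]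
  congr 2
  ring

lemma IsCovariant.posComm (hK : IsCovariant A Γ K) (i : Fin 2) :
    IsCovariant A Γ (posComm i K) := by
  intro γ hγ x y
  simp only [_root_.posComm, hK γ hγ x y, PiLp.sub_apply, sub_sub_sub_cancel_right]
  ring

variable (A Γ) in
/-- The additive group of localized covariant kernels. -/
def localizedKernels : AddSubgroup (R2 × R2 → ℂ) where
  carrier := {K | IsLocalized K ∧ IsCovariant A Γ K}
  zero_mem' := ⟨isLocalized_zero, fun γ _ x y => by simp⟩
  add_mem' h h' := ⟨h.1.add h'.1, fun γ hγ x y => by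
    simp only [Pi.add_apply, h.2 γ hγ x y, h'.2 γ hγ x y, mul_add]⟩
  neg_mem' h := ⟨h.1.neg, fun γ hγ x y => by simp only [Pi.neg_apply, h.2 γ hγ x y, mul_neg]⟩

instance : Mul (localizedKernels A Γ) :=
  ⟨fun a b => ⟨compK a b, a.2.1.compK b.2.1, a.2.2.compK b.2.2⟩⟩

lemma coe_mul_localizedKernels (a b : localizedKernels A Γ) :
    ((a * b : localizedKernels A Γ) : R2 × R2 → ℂ) = compK a b := rfl

instance : NonUnitalRing (localizedKernels A Γ) :=
  { (inferInstance : AddCommGroup (localizedKernels A Γ)),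
    (inferInstance : Mul (localizedKernels A Γ)) with
    left_distrib := fun a b c => Subtype.ext (compK_add_right a.2.1 b.2.1 c.2.1)
    right_distrib := fun a b c => Subtype.ext (compK_add_left a.2.1 b.2.1 c.2.1)
    zero_mul := fun a => Subtype.ext (by ext; simp [coe_mul_localizedKernels, compK])
    mul_zero := fun a => Subtype.ext (by ext; simp [coe_mul_localizedKernels, compK])
    mul_assoc := fun a b c => Subtype.ext (compK_assoc a.2.1 b.2.1 c.2.1) }

variable (A Γ) in
/-- The derivation `K ↦ [Xᵢ, K]` on localized covariant kernels. -/
def posDeriv (i : Fin 2) : localizedKernels A Γ →+ localizedKernels A Γ where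
  toFun a := ⟨posComm i a, a.2.1.posComm i, a.2.2.posComm i⟩
  map_zero' := Subtype.ext (by ext; simp [posComm])
  map_add' a b := Subtype.ext (by ext; simp [posComm, mul_add])

lemma coe_posDeriv (i : Fin 2) (a : localizedKernels A Γ) :
    (posDeriv A Γ i a : R2 × R2 → ℂ) = posComm i a := rfl

lemma posDeriv_mul (i : Fin 2) (a b : localizedKernels A Γ) :
    posDeriv A Γ i (a * b) = posDeriv A Γ i a * b + a * posDeriv A Γ i b :=
  Subtype.ext (posComm_compK a.2.1 b.2.1 i)

lemma posDeriv_comm (i j : Fin 2) (a : localizedKernels A Γ) :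
    posDeriv A Γ i (posDeriv A Γ j a) = posDeriv A Γ j (posDeriv A Γ i a) :=
  Subtype.ext (by ext; simp only [coe_posDeriv, posComm]; ring)

end Covariant

section UnitCell

open scoped Pointwise

lemma isCompact_unitCell (a₁ a₂ : R2) : IsCompact (unitCell a₁ a₂) := by
  have h : unitCell a₁ a₂ = (fun t : ℝ × ℝ => t.1 • a₁ + t.2 • a₂) ''
      (Set.Icc (-(1/2) : ℝ) (1/2) ×ˢ Set.Icc (-(1/2) : ℝ) (1/2)) := by
    ext x
    constructor
    · rintro ⟨s, t, hs, ht, rfl⟩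
      exact ⟨(s, t), ⟨hs, ht⟩, rfl⟩
    · rintro ⟨⟨s, t⟩, ⟨hs, ht⟩, rfl⟩
      exact ⟨s, t, hs, ht, rfl⟩
  rw [h]
  exact (isCompact_Icc.prod isCompact_Icc).image (by fun_prop)

lemma unitCell_eq_vadd_parallelepiped (a₁ a₂ : R2) :
    unitCell a₁ a₂ = -((1/2 : ℝ) • (a₁ + a₂)) +ᵥ parallelepiped ![a₁, a₂] := by
  ext x
  rw [Set.mem_vadd_set_iff_neg_vadd_mem, neg_neg, vadd_eq_add, mem_parallelepiped_iff]
  constructor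
  · rintro ⟨s, t, hs, ht, rfl⟩
    refine ⟨![s + 1/2, t + 1/2], ⟨fun k => ?_, fun k => ?_⟩, ?_⟩
    · fin_cases k <;> simp <;> linarith [hs.1, ht.1]
    · fin_cases k <;> simp <;> linarith [hs.2, ht.2]
    · simp only [Fin.sum_univ_two, Matrix.cons_val_zero, Matrix.cons_val_one]
      module
  · rintro ⟨t, ht, h⟩
    have h0 := ht.1 0
    have h1 := ht.1 1
    have h2 := ht.2 0
    have h3 := ht.2 1
    simp only [Pi.zero_apply, Pi.one_apply] at h0 h1 h2 h3
    refine ⟨t 0 - 1/2, t 1 - 1/2, ⟨by linarith, by linarith⟩, ⟨by linarith, by linarith⟩, ?_⟩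
    simp only [Fin.sum_univ_two, Matrix.cons_val_zero, Matrix.cons_val_one] at h
    rw [eq_sub_of_add_eq' h]
    module

/-- The integral of a lattice periodic function over the unit cell is translation invariant. -/
lemma setIntegral_unitCell_sub {a₁ a₂ : R2} (hlin : LinearIndependent ℝ ![a₁, a₂])
    {g : R2 → ℂ} (hg : ∀ γ ∈ lattice a₁ a₂, ∀ x, g (x - γ) = g x) (t : R2) :
    ∫ x in unitCell a₁ a₂, g (x - t) = ∫ x in unitCell a₁ a₂, g x := by
  let b : Module.Basis (Fin 2) ℝ R2 := basisOfLinearIndependentOfCardEqFinrank hlin (by simp)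
  have hb : (b : Fin 2 → R2) = ![a₁, a₂] := coe_basisOfLinearIndependentOfCardEqFinrank _ _
  set G := (Submodule.span ℤ (Set.range b)).toAddSubgroup with hG
  have : Countable G := (inferInstance : Countable (Submodule.span ℤ (Set.range b)))
  have hper : ∀ (γ : G) (x : R2), g (γ +ᵥ x) = g x := by
    rintro ⟨γ, hγ⟩ x
    rw [hG, Submodule.mem_toAddSubgroup, hb, Matrix.range_cons_cons_empty, Submodule.mem_span_pair] at hγ
    obtain ⟨m, n, h⟩ := hγ
    have h1 := hg (-γ) ⟨-m, -n, by rw [← h]; module⟩ x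
    rwa [sub_neg_eq_add, add_comm] at h1
  have hfd : ∀ s : R2, IsAddFundamentalDomain G (s +ᵥ ZSpan.fundamentalDomain b) :=
    fun s => (ZSpan.isAddFundamentalDomain' b volume).vadd_of_comm s
  have hae : ∀ s : R2, (s +ᵥ unitCell a₁ a₂ : Set R2) =ᵐ[volume]
      ((s + -((1/2 : ℝ) • (a₁ + a₂))) +ᵥ ZSpan.fundamentalDomain b : Set R2) := by
    intro s
    rw [unitCell_eq_vadd_parallelepiped, ← add_vadd, ← hb]
    exact (vadd_set_ae_eq _).2 (ZSpan.fundamentalDomain_ae_parallelepiped b volume).symm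
  have h0 := hae 0
  rw [zero_vadd] at h0
  calc ∫ x in unitCell a₁ a₂, g (x - t) = ∫ x in -t +ᵥ unitCell a₁ a₂, g x := by
        simp only [sub_eq_neg_add]
        exact ((measurePreserving_vadd (-t) volume).setIntegral_image_emb
          (measurableEmbedding_const_vadd (-t)) g (unitCell a₁ a₂)).symm
    _ = ∫ x in unitCell a₁ a₂, g x := by
        rw [setIntegral_congr_set (hae (-t)), setIntegral_congr_set h0]
        exact (hfd _).setIntegral_eq (hfd _) hper

end UnitCell

section Trace

variable {A : R2 → R2} {a₁ a₂ : R2}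

lemma integrableOn_diag {K : R2 × R2 → ℂ} (hK : Continuous K) :
    IntegrableOn (fun x : R2 => K (x, x)) (unitCell a₁ a₂) :=
  ContinuousOn.integrableOn_compact (isCompact_unitCell a₁ a₂) (by fun_prop)

variable (A a₁ a₂) in
/-- The integral of the diagonal of a kernel over the unit cell. -/
def cellTrace : localizedKernels A (lattice a₁ a₂) →+ ℂ where
  toFun a := ∫ x in unitCell a₁ a₂, (a : R2 × R2 → ℂ) (x, x)
  map_zero' := by simp
  map_add' a b := integral_add (integrableOn_diag a.2.1.continuous)
    (integrableOn_diag b.2.1.continuous)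

lemma cellTrace_apply (a : localizedKernels A (lattice a₁ a₂)) :
    cellTrace A a₁ a₂ a = ∫ x in unitCell a₁ a₂, (a : R2 × R2 → ℂ) (x, x) := rfl

lemma cellTrace_posDeriv (i : Fin 2) (a : localizedKernels A (lattice a₁ a₂)) :
    cellTrace A a₁ a₂ (posDeriv A (lattice a₁ a₂) i a) = 0 := by
  simp [cellTrace_apply, coe_posDeriv, posComm]

lemma cellTrace_mul_comm (hlin : LinearIndependent ℝ ![a₁, a₂])
    (a b : localizedKernels A (lattice a₁ a₂)) :
    cellTrace A a₁ a₂ (a * b) = cellTrace A a₁ a₂ (b * a) := by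
  obtain ⟨K, hK, hKc⟩ := a
  obtain ⟨L, hL, hLc⟩ := b
  obtain ⟨C, C', β, hβ, h, h'⟩ := hK.common hL
  have hKcont := h.1
  have hLcont := h'.1
  have hC := h.nonneg
  have : IsFiniteMeasure (volume.restrict (unitCell a₁ a₂)) :=
    isFiniteMeasure_restrict.2 (isCompact_unitCell a₁ a₂).measure_lt_top.ne
  have hint : ∀ u v : R2 → R2 → R2, Continuous (Function.uncurry u) →
      Continuous (Function.uncurry v) → (∀ x t, ‖u x t - v x t‖ = ‖t‖) →
      Integrable (Function.uncurry fun x t => K (u x t, v x t) * L (v x t, u x t))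
        ((volume.restrict (unitCell a₁ a₂)).prod volume) := by
    intro u v hu hv huv
    have hb : Integrable (fun q : R2 × R2 => (1 : ℝ) * (C * Real.exp (-β * ‖q.2‖) * C'))
        ((volume.restrict (unitCell a₁ a₂)).prod volume) :=
      (integrable_const (1 : ℝ)).mul_prod
        (((integrable_exp_neg_mul_norm hβ).const_mul C).mul_const C')
    refine hb.mono' ?_ (.of_forall fun q => ?_)
    · exact ((hKcont.comp (hu.prodMk hv)).mul
        (hLcont.comp (hv.prodMk hu))).aestronglyMeasurable
    · simp only [Function.uncurry, norm_mul, one_mul]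
      gcongr
      · rw [← huv q.1 q.2]; exact h.2 _ _
      · exact h'.norm_le hβ _ _
  simp only [cellTrace_apply, coe_mul_localizedKernels, compK]
  calc ∫ x in unitCell a₁ a₂, ∫ y, K (x, y) * L (y, x)
      = ∫ x in unitCell a₁ a₂, ∫ t, K (x, x - t) * L (x - t, x) := by
        congr 1 with x
        exact (integral_sub_left_eq_self (fun y => K (x, y) * L (y, x)) volume x).symm
    _ = ∫ t, ∫ x in unitCell a₁ a₂, K (x, x - t) * L (x - t, x) :=
        integral_integral_swap (hint (fun x _ => x) (fun x t => x - t) (by fun_prop)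
          (by unfold Function.uncurry; fun_prop) (by simp))
    _ = ∫ t, ∫ x in unitCell a₁ a₂, K (x + t, x) * L (x, x + t) := by
        congr 1 with t
        rw [← setIntegral_unitCell_sub hlin (g := fun x => K (x + t, x) * L (x, x + t)) ?_ t]
        · simp only [sub_add_cancel]
        · intro γ hγ x
          have := hKc.mul_swap hLc hγ (x + t) x
          rwa [add_sub_right_comm] at this
    _ = ∫ x in unitCell a₁ a₂, ∫ t, K (x + t, x) * L (x, x + t) :=
        (integral_integral_swap (hint (fun x t => x + t) (fun x _ => x)
          (by unfold Function.uncurry; fun_prop) (by unfold Function.uncurry; fun_prop)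
          (by simp))).symm
    _ = ∫ x in unitCell a₁ a₂, ∫ y, L (x, y) * K (y, x) := by
        congr 1 with x
        simp only [mul_comm (L _)]
        exact integral_add_left_eq_self (fun y => K (y, x) * L (x, y)) x

end Trace

section Wedge

variable {A : R2 → R2} {Γ : Set R2}

lemma Wint_eq_chains (q : R2 × R2 → ℂ) (i j : Fin 2) (x : R2) :
    Wint q i j x = fun yz =>
      posComm j q (x, yz.1) * (q (yz.1, yz.2) * posComm i q (yz.2, x))
      - posComm i q (x, yz.1) * (q (yz.1, yz.2) * posComm j q (yz.2, x))
      - (x j : ℂ) * (posComm i q (x, yz.1) * (q (yz.1, yz.2) * q (yz.2, x)))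
      + (x i : ℂ) * (posComm j q (x, yz.1) * (q (yz.1, yz.2) * q (yz.2, x)))
      + (x i : ℂ) * (q (x, yz.1) * (q (yz.1, yz.2) * posComm j q (yz.2, x)))
      - (x j : ℂ) * (q (x, yz.1) * (q (yz.1, yz.2) * posComm i q (yz.2, x))) := by
  ext yz
  simp only [Wint, posComm]
  push_cast
  ring

lemma IsLocalized.integrable_Wint {q : R2 × R2 → ℂ} (hq : IsLocalized q) (i j : Fin 2) (x : R2) :
    Integrable (Wint q i j x) := by
  have hi := hq.posComm i
  have hj := hq.posComm j
  rw [Wint_eq_chains]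
  exact (((((hj.integrable_chain hq hi x x).sub (hi.integrable_chain hq hj x x)).sub
    ((hi.integrable_chain hq hq x x).const_mul _)).add
    ((hj.integrable_chain hq hq x x).const_mul _)).add
    ((hq.integrable_chain hq hj x x).const_mul _)).sub
    ((hq.integrable_chain hq hi x x).const_mul _)

/-- For an idempotent kernel, `W_q` is the diagonal of a combination of bounded kernels. -/
lemma W_eq_diag (q : localizedKernels A Γ) (hq : q * q = q) (i j : Fin 2) (x : R2) :
    W q i j x = ((posDeriv A Γ j q * (q * posDeriv A Γ i q)
      - posDeriv A Γ i q * (q * posDeriv A Γ j q) : localizedKernels A Γ) :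
        R2 × R2 → ℂ) (x, x) := by
  have hl := q.2.1
  have hi := hl.posComm i
  have hj := hl.posComm j
  have hdiag : ∀ k : Fin 2, compK (posComm k q) (compK q q) (x, x)
      + compK q (compK q (posComm k q)) (x, x) = 0 := by
    intro k
    have h1 : posDeriv A Γ k q * (q * q) + q * (q * posDeriv A Γ k q) = posDeriv A Γ k q := by
      rw [← mul_assoc q q, hq, ← posDeriv_mul, hq]
    have h2 := congrFun (congrArg Subtype.val h1) (x, x)
    have h3 : (posDeriv A Γ k q : R2 × R2 → ℂ) (x, x) = 0 := by
      simp [coe_posDeriv, posComm]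
    exact h2.trans h3
  have hW : W q i j x = ∫ yz : R2 × R2, Wint q i j x yz := by
    rw [Measure.volume_eq_prod, integral_prod _ (hl.integrable_Wint i j x)]
    rfl
  have i1 := hj.integrable_chain hl hi x x
  have i2 := hi.integrable_chain hl hj x x
  have i3 := (hi.integrable_chain hl hl x x).const_mul (x j : ℂ)
  have i4 := (hj.integrable_chain hl hl x x).const_mul (x i : ℂ)
  have i5 := (hl.integrable_chain hl hj x x).const_mul (x i : ℂ)
  have i6 := (hl.integrable_chain hl hi x x).const_mul (x j : ℂ)
  rw [hW, Wint_eq_chains]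
  refine (integral_sub' ((((i1.sub i2).sub i3).add i4).add i5) i6).trans ?_
  rw [integral_add' (((i1.sub i2).sub i3).add i4) i5, integral_add' ((i1.sub i2).sub i3) i4,
    integral_sub' (i1.sub i2) i3, integral_sub' i1 i2]
  simp only [integral_const_mul]
  rw [integral_chain hj hl hi, integral_chain hi hl hj, integral_chain hi hl hl,
    integral_chain hj hl hl, integral_chain hl hl hj, integral_chain hl hl hi]
  change _ = compK (posComm j q) (compK q (posComm i q)) (x, x)
    - compK (posComm i q) (compK q (posComm j q)) (x, x)
  linear_combination (x i : ℂ) * hdiag j - (x j : ℂ) * hdiag i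

lemma setIntegral_W {a₁ a₂ : R2} (hlin : LinearIndependent ℝ ![a₁, a₂])
    (q : localizedKernels A (lattice a₁ a₂)) (hq : q * q = q) (i j : Fin 2) :
    ∫ x in unitCell a₁ a₂, W q i j x = cellTrace A a₁ a₂
      (q * (posDeriv A _ i q * posDeriv A _ j q - posDeriv A _ j q * posDeriv A _ i q)) := by
  simp only [W_eq_diag q hq]
  rw [← cellTrace_apply, mul_sub, map_sub, map_sub, cellTrace_mul_comm hlin,
    cellTrace_mul_comm hlin (posDeriv A _ i q), mul_assoc, mul_assoc]

end Wedge

section Conjugation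

variable {S M : Type*} [NonUnitalRing S] [AddCommGroup M]

/-- Invariance of the Chern number under conjugation by `1 + v`, where the unit is provided by a
ring `R` containing `S` to which the derivations and the trace extend by means of `π`. -/
lemma trace_chern_conj_of_embedding {R : Type*} [Ring R] (ι : S →ₙ+* R) (π : R →+ S)
    (hπ : ∀ a, π (ι a) = a) (D₁ D₂ : S →+ S) (T : S →+ M)
    (cyc : ∀ a b : R, T (π (a * b)) = T (π (b * a)))
    (h₁ : ∀ a b : R, ι (D₁ (π (a * b))) = ι (D₁ (π a)) * b + a * ι (D₁ (π b)))
    (h₂ : ∀ a b : R, ι (D₂ (π (a * b))) = ι (D₂ (π a)) * b + a * ι (D₂ (π b)))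
    (hcomm : ∀ a, D₁ (D₂ a) = D₂ (D₁ a))
    (hT₁ : ∀ a, T (D₁ a) = 0) (hT₂ : ∀ a, T (D₂ a) = 0)
    {e v v' f : S} (he : e * e = e) (hv : v + v' + v * v' = 0) (hv' : v + v' + v' * v = 0)
    (hf : f = e + v * e + e * v' + v * (e * v')) :
    f * f = f ∧ T (f * (D₁ f * D₂ f - D₂ f * D₁ f)) = T (e * (D₁ e * D₂ e - D₂ e * D₁ e)) := by
  have huw : (1 + ι v) * (1 + ι v') = 1 := by
    have h : (1 + ι v) * (1 + ι v') = 1 + (ι v + ι v' + ι v * ι v') := by noncomm_ring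
    rw [h, ← map_mul, ← map_add, ← map_add, hv, map_zero, add_zero]
  have hwu : (1 + ι v') * (1 + ι v) = 1 := by
    have h : (1 + ι v') * (1 + ι v) = 1 + (ι v + ι v' + ι v' * ι v) := by noncomm_ring
    rw [h, ← map_mul, ← map_add, ← map_add, hv', map_zero, add_zero]
  have hee : ι e * ι e = ι e := by rw [← map_mul, he]
  have hff : (1 + ι v) * ι e * (1 + ι v') = ι f := by
    rw [hf]
    simp only [map_add, map_mul]
    noncomm_ring
  constructor
  · have h : ι (f * f) = ι f := by
      rw [map_mul, ← hff]
      calc _ = (1 + ι v) * ι e * ((1 + ι v') * (1 + ι v)) * ι e * (1 + ι v') := by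
            simp only [mul_assoc]
        _ = (1 + ι v) * (ι e * ι e) * (1 + ι v') := by rw [hwu]; simp only [mul_assoc, mul_one]
        _ = _ := by rw [hee]
    rw [← hπ (f * f), h, hπ]
  · have key := trace_chern_conj (((ι : S →+ R).comp D₁).comp π) (((ι : S →+ R).comp D₂).comp π)
      (T.comp π) cyc h₁ h₂ (fun a => by simp [hπ, hcomm]) (fun a => by simp [hπ, hT₁])
      (fun a => by simp [hπ, hT₂]) hee huw hwu
    rw [hff] at key
    simpa only [AddMonoidHom.comp_apply, AddMonoidHom.coe_coe, hπ, ← map_mul, ← map_sub]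
      using key

/-- Invariance of the Chern number in a non-unital ring under conjugation by `1 + v`. -/
theorem trace_chern_conj_nonUnital
    (D₁ D₂ : S →+ S) (T : S →+ M) (cyc : ∀ a b, T (a * b) = T (b * a))
    (h₁ : ∀ a b, D₁ (a * b) = D₁ a * b + a * D₁ b)
    (h₂ : ∀ a b, D₂ (a * b) = D₂ a * b + a * D₂ b)
    (hcomm : ∀ a, D₁ (D₂ a) = D₂ (D₁ a))
    (hT₁ : ∀ a, T (D₁ a) = 0) (hT₂ : ∀ a, T (D₂ a) = 0)
    {e v v' f : S} (he : e * e = e) (hv : v + v' + v * v' = 0) (hv' : v + v' + v' * v = 0)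
    (hf : f = e + v * e + e * v' + v * (e * v')) :
    f * f = f ∧ T (f * (D₁ f * D₂ f - D₂ f * D₁ f)) = T (e * (D₁ e * D₂ e - D₂ e * D₁ e)) := by
  have leibniz : ∀ D : S →+ S, (∀ a b, D (a * b) = D a * b + a * D b) →
      ∀ a b : Unitization ℤ S, (Unitization.inr (D (a * b).snd) : Unitization ℤ S)
        = Unitization.inr (D a.snd) * b + a * Unitization.inr (D b.snd) := by
    intro D hD a b
    refine Unitization.ext ?_ ?_
    · simp
    · simp only [Unitization.snd_inr, Unitization.snd_add, Unitization.snd_mul,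
        Unitization.fst_inr, map_add, map_zsmul, hD, zero_smul, zero_add, add_zero]
      abel
  refine trace_chern_conj_of_embedding
    ((Unitization.inrNonUnitalAlgHom ℤ S : S →ₙₐ[ℤ] Unitization ℤ S) : S →ₙ+* Unitization ℤ S)
    (Unitization.sndHom ℤ ℤ S).toAddMonoidHom (fun _ => rfl) D₁ D₂ T (fun a b => ?_)
    (fun a b => leibniz D₁ h₁ a b) (fun a b => leibniz D₂ h₂ a b) hcomm hT₁ hT₂ he hv hv' hf
  change T (a * b).snd = T (b * a).snd
  simp only [Unitization.snd_mul, map_add, cyc]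
  abel

end Conjugation

/-- Proposition 4.5, Chern–Simons formula. Let `p` be the JCEL, magnetic
periodic kernel of an orthogonal projection `P`, and `V` a JCEL, magnetic periodic kernel
with `U = Id + V` unitary. With `p_U` the kernel of `U·P·U⁻¹`, the integrals defining
`W_{p_U}` and `W_p` converge absolutely, and
`∫_{Λ₁} W_{p_U}(x) dx = ∫_{Λ₁} W_p(x) dx`. -/
theorem stmt_13 (a₁ a₂ : R2) (hlin : LinearIndependent ℝ ![a₁, a₂])
    (b₀ : ℝ) (Aper : R2 → R2) (hAper : Continuous Aper)
    (hAperiodic : ∀ γ ∈ lattice a₁ a₂, ∀ x : R2, Aper (x + γ) = Aper x)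
    (A : R2 → R2) (hA : A = fun x => (b₀/2) • vec2 (-(x 1)) (x 0) + Aper x)
    (p V : R2 × R2 → ℂ) (Cp βp CV βV : ℝ)
    (hCp : 0 < Cp) (hβp : 0 < βp) (hCV : 0 < CV) (hβV : 0 < βV)
    (hp : JCEL p Cp βp) (hV : JCEL V CV βV)
    (hpmpc : MPC A (lattice a₁ a₂) p) (hVmpc : MPC A (lattice a₁ a₂) V)
    (hidem : ∀ x x' : R2, compK p p (x, x') = p (x, x'))
    (hherm : ∀ x x' : R2, p (x, x') = (starRingEnd ℂ) (p (x', x)))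
    (hUUstar : ∀ q : R2 × R2, V q + starK V q + compK V (starK V) q = 0)
    (hUstarU : ∀ q : R2 × R2, V q + starK V q + compK (starK V) V q = 0)
    (i j : Fin 2) (hij : i ≠ j) :
    (∀ x : R2, Integrable (Wint (conjK p V) i j x)) ∧
    (∀ x : R2, Integrable (Wint p i j x)) ∧
    ∫ x in unitCell a₁ a₂, W (conjK p V) i j x = ∫ x in unitCell a₁ a₂, W p i j x := by
  let S := localizedKernels A (lattice a₁ a₂)
  have hpl : IsLocalized p := ⟨Cp, βp, hβp, hp⟩
  have hVl : IsLocalized V := ⟨CV, βV, hβV, hV⟩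
  let e : S := ⟨p, hpl, hpmpc.isCovariant⟩
  let v : S := ⟨V, hVl, hVmpc.isCovariant⟩
  let v' : S := ⟨starK V, hVl.starK, hVmpc.isCovariant.starK⟩
  let f : S := e + v * e + e * v' + v * (e * v')
  have hf : (f : R2 × R2 → ℂ) = conjK p V := rfl
  have he : e * e = e := Subtype.ext (funext fun q => hidem q.1 q.2)
  obtain ⟨hff, htrace⟩ := trace_chern_conj_nonUnital (posDeriv A (lattice a₁ a₂) i)
    (posDeriv A (lattice a₁ a₂) j) (cellTrace A a₁ a₂) (cellTrace_mul_comm hlin)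
    (posDeriv_mul i) (posDeriv_mul j) (posDeriv_comm i j) (cellTrace_posDeriv i)
    (cellTrace_posDeriv j) he (v := v) (v' := v') (Subtype.ext (funext hUUstar))
    (Subtype.ext (funext hUstarU)) (f := f) rfl
  refine ⟨fun x => ?_, hpl.integrable_Wint i j, ?_⟩
  · rw [← hf]
    exact f.2.1.integrable_Wint i j x
  · rw [← hf, setIntegral_W hlin f hff, htrace]
    exact (setIntegral_W hlin e he i j).symm
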